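/- Let S be a commutative ring, m ≥ 2, and let A be an (m−1) × m matrix with entries in the polynomial ring S[X]. Let a_1, …, a_m ∈ ℕ and assume that Σ_{j=1}^m (X^{a_j} − 1) · (j-th column of A) = 0 in S[X]^{m−1}. Let A(1) denote the matrix over S obtained by evaluating every entry at X = 1, and for 1 ≤ k ≤ m let A(1)_{k̂} denote A(1) with the k-th column deleted. Then for all 1 ≤ k, k' ≤ m one has a_k · det(A(1)_{k̂'}) = (−1)^{k+k'} · a_{k'} · det(A(1)_{k̂}) in S (where a_k, a_{k'} are the images of these natural numbers in S). -/

import Mathlib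

/-- The order-preserving injection `Fin (m - 1) → Fin m` that skips the index `k`. -/
def skipIdx {m : ℕ} (k : Fin m) (j : Fin (m - 1)) : Fin m :=
  if (j : ℕ) < (k : ℕ) then ⟨(j : ℕ), by have := j.isLt; omega⟩
  else ⟨(j : ℕ) + 1, by have := j.isLt; omega⟩

theorem minor_aux {S : Type*} [CommRing S] (n : ℕ) (B : Matrix (Fin n) (Fin (n + 1)) S)
    (c : Fin (n + 1) → S) (h : ∀ i, ∑ j, c j * B i j = 0) (k k' : Fin (n + 1)) :
    c k * (B.submatrix id k'.succAbove).det =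
      (-1 : S) ^ ((k : ℕ) + (k' : ℕ)) * (c k' * (B.submatrix id k.succAbove).det) := by
  let M : Matrix (Fin (n + 1)) (Fin (n + 1)) S :=
    Matrix.of (Fin.cons (Pi.single k' 1) (fun i => B i))
  have hsub : ∀ j : Fin (n + 1), M.submatrix (Fin.succ) j.succAbove =
      B.submatrix id j.succAbove := by
    intro j
    ext x y
    simp [M]
  have hMc : M.mulVec c = Pi.single 0 (c k') := by
    ext i
    refine Fin.cases ?_ (fun i => ?_) i
    · simp [M, Matrix.mulVec, dotProduct, Pi.single_apply]
    · have := h i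
      simp only [Matrix.mulVec, dotProduct, M, Matrix.of_apply, Fin.cons_succ]
      rw [Pi.single_eq_of_ne (Fin.succ_ne_zero i), ← this]
      exact Finset.sum_congr rfl (fun j _ => mul_comm _ _)
  have hdet : M.det = (-1) ^ (k' : ℕ) * (B.submatrix id k'.succAbove).det := by
    rw [Matrix.det_succ_row_zero, Finset.sum_eq_single k']
    · rw [hsub]; simp [M]
    · intro b _ hb
      simp [M, Pi.single_eq_of_ne hb]
    · simp
  have key : M.det * c k = M.adjugate k 0 * c k' := by
    have h1 : (M.adjugate.mulVec (M.mulVec c)) k = M.det * c k := by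
      rw [Matrix.mulVec_mulVec, Matrix.adjugate_mul, Matrix.smul_mulVec, Matrix.one_mulVec]
      simp
    rw [← h1, hMc]
    simp [Matrix.mulVec_single]
  have hadj : M.adjugate k 0 = (-1) ^ (k : ℕ) * (B.submatrix id k.succAbove).det := by
    rw [Matrix.adjugate_fin_succ_eq_det_submatrix, Fin.succAbove_zero, hsub]
    simp
  rw [hdet, hadj] at key
  have hs : ((-1 : S) ^ (k' : ℕ)) * (-1) ^ (k' : ℕ) = 1 := by
    rw [← mul_pow]; simp
  rw [pow_add]
  linear_combination ((-1 : S) ^ (k' : ℕ)) * key -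
    c k * (B.submatrix id k'.succAbove).det * hs

theorem skipIdx_eq {n : ℕ} (k : Fin (n + 1)) (j : Fin n) :
    skipIdx (m := n + 1) k j = k.succAbove j := by
  ext
  simp only [skipIdx, Fin.succAbove, Fin.lt_def, Fin.val_castSucc]
  split_ifs <;> simp_all

/-- Let `S` be a commutative ring, `m ≥ 2`, and `A` an `(m-1) × m` matrix over `S[X]`.
Let `a 1, …, a m` be natural numbers with `∑ j, (X ^ (a j) - 1) * (j-th column of A) = 0`.
Let `A(1)` be the evaluation of `A` at `X = 1` and `A(1)_{k̂}` the matrix `A(1)` with the `k`-th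
column deleted.  Then `(a k) * det (A(1)_{k̂'}) = (-1)^(k + k') * (a k') * det (A(1)_{k̂})` in `S`. -/
theorem stmt1 {S : Type*} [CommRing S] (m : ℕ) (hm : 2 ≤ m)
    (A : Matrix (Fin (m - 1)) (Fin m) (Polynomial S))
    (a : Fin m → ℕ)
    (hA : ∀ i : Fin (m - 1), ∑ j : Fin m, (Polynomial.X ^ (a j) - 1) * A i j = 0)
    (k k' : Fin m) :
    (a k : S) * (Matrix.of fun (i j : Fin (m - 1)) => (A i (skipIdx k' j)).eval 1).det =
      (-1 : S) ^ ((k : ℕ) + (k' : ℕ)) *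
        ((a k' : S) * (Matrix.of fun (i j : Fin (m - 1)) => (A i (skipIdx k j)).eval 1).det) := by
  obtain ⟨n, rfl⟩ : ∃ n, m = n + 1 := ⟨m - 1, by omega⟩
  have h := minor_aux n (Matrix.of fun i j => (A i j).eval 1) (fun j => (a j : S)) ?_ k k'
  · have e : ∀ q : Fin (n + 1),
        (Matrix.of fun (i j : Fin (n + 1 - 1)) => (A i (skipIdx q j)).eval 1) =
        (Matrix.of fun (i : Fin n) (j : Fin (n + 1)) => (A i j).eval 1).submatrix id
          q.succAbove := by
      intro q
      ext i j
      exact congrArg (fun t => (A i t).eval 1) (skipIdx_eq q j)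
    rw [e, e]
    exact h
  · intro i
    have h0 : (∑ j, (∑ t ∈ Finset.range (a j), (Polynomial.X : Polynomial S) ^ t) * A i j) *
        (Polynomial.X - Polynomial.C 1) = 0 := by
      rw [← hA i, Finset.sum_mul]
      refine Finset.sum_congr rfl (fun j _ => ?_)
      rw [← geom_sum_mul, Polynomial.C_1]
      ring
    have h1 := (Polynomial.monic_X_sub_C (1 : S)).mul_left_eq_zero_iff.mp h0
    have h2 := congrArg (Polynomial.eval 1) h1
    simpa [Polynomial.eval_finsetSum] using h2
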